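/- Claim 3.2 (existence of a heavy K_{s−2}): Let r, s ≥ 3 be integers and set t = r + s − 3. Let G be an n-vertex finite simple graph with minimum degree δ(G) ≥ (((s−3)(r−1)+1)/((s−2)(r−1)+1))·n, and let v: V(G) → 𝔽_2^t satisfy: for every set of s−2 vertices forming a clique in G, the number of indices j ∈ {1,…,t} at which all of their vectors have coordinate 1 is at most 1. Suppose moreover that Σ_{x ∈ V(G)} ‖v(x)‖ > (((s−3)(r−1)+1)/((s−2)(r−1)+1))·t·n. Then there exist vertices x_0, x_1, …, x_{s−3} of G forming a clique on s−2 vertices such that Σ_{j=0}^{s−3} ‖v(x_j)‖ = 1 + t(s−3), ‖v(x_0)‖ = max{‖v(y)‖ : y ∈ V(G)}, and for every i with 0 ≤ i ≤ s−4, ‖v(x_{i+1})‖ = max{‖v(y)‖ : y ∈ ∩_{0 ≤ j ≤ i} N_G(x_j)}. -/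

import Mathlib

open SimpleGraph Finset

/-- The number of coordinates of a binary vector equal to `1`. -/
def weight {t : ℕ} (w : Fin t → ZMod 2) : ℕ :=
  (Finset.univ.filter fun j : Fin t => w j = 1).card

/-- If every initial segment of length less than `k` can be extended, then there is a sequence of
length `k` each of whose terms is chosen greedily, with `f` as large as possible. -/
theorem exists_greedy_sequence {V : Type*} [Finite V] [Nonempty V] (R : V → V → Prop) (f : V → ℕ)
    (k : ℕ) (hext : ∀ x : ℕ → V, ∀ m < k, ∃ y, ∀ j < m, R (x j) y) :
    ∃ x : ℕ → V, ∀ i < k, (∀ j < i, R (x j) (x i)) ∧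
      ∀ y, (∀ j < i, R (x j) y) → f y ≤ f (x i) := by
  suffices h : ∀ m ≤ k, ∃ x : ℕ → V, ∀ i < m, (∀ j < i, R (x j) (x i)) ∧
      ∀ y, (∀ j < i, R (x j) y) → f y ≤ f (x i) from h k le_rfl
  intro m
  induction m with
  | zero => exact fun _ => ⟨fun _ => Classical.arbitrary V, by simp⟩
  | succ m ih =>
    intro hm
    obtain ⟨x, hx⟩ := ih (by omega)
    obtain ⟨z, hz, hmax⟩ :=
      Set.exists_max_image {y | ∀ j < m, R (x j) y} f (Set.toFinite _) (hext x m (by omega))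
    refine ⟨Function.update x m z, fun i hi => ?_⟩
    have hlt : ∀ j < m, Function.update x m z j = x j := fun j hj =>
      Function.update_of_ne (by omega) _ _
    have hcongr : ∀ y, (∀ j < i, R (Function.update x m z j) y) ↔ ∀ j < i, R (x j) y := fun y =>
      forall₂_congr fun j hj => by rw [hlt j (by omega)]
    simp only [hcongr]
    rcases Nat.lt_succ_iff_lt_or_eq.mp hi with hi' | rfl
    · rw [hlt i hi']
      exact hx i hi'
    · rw [Function.update_self]
      exact ⟨hz, hmax⟩

/-- The total weight of a set of binary vectors is at most `t (|S| - 1)` plus the number of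
coordinates at which all of them are `1`. -/
theorem sum_weight_le {V : Type*} {t : ℕ} (v : V → Fin t → ZMod 2) (S : Finset V) :
    ∑ x ∈ S, weight (v x) ≤
      (Finset.univ.filter fun j : Fin t => ∀ x ∈ S, v x j = 1).card + t * (S.card - 1) := by
  classical
  have hswap : ∑ x ∈ S, weight (v x) = ∑ j : Fin t, (S.filter fun x => v x j = 1).card :=
    Finset.sum_card_bipartiteAbove_eq_sum_card_bipartiteBelow fun x j => v x j = 1
  calc ∑ x ∈ S, weight (v x) = ∑ j : Fin t, (S.filter fun x => v x j = 1).card := hswap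
    _ ≤ ∑ j : Fin t, ((if ∀ x ∈ S, v x j = 1 then 1 else 0) + (S.card - 1)) := by
      refine Finset.sum_le_sum fun j _ => ?_
      split_ifs with h
      · exact (Finset.card_filter_le _ _).trans (by omega)
      · have hne : ∃ x ∈ S, ¬ v x j = 1 := by simpa using h
        have := Finset.card_lt_card (Finset.filter_ssubset.mpr hne)
        omega
    _ = _ := by simp [Finset.sum_add_distrib]

theorem weight_le {t : ℕ} (w : Fin t → ZMod 2) : weight w ≤ t :=
  (Finset.card_filter_le _ _).trans (by simp)

/-- If every vertex has at most `b` non-neighbors (itself included) and `m * b` is less than the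
number of vertices, then any `m` vertices have a common neighbor. -/
theorem exists_common_neighbor {V : Type*} [Fintype V] (G : SimpleGraph V) [DecidableRel G.Adj]
    (b : ℝ) (hb : ∀ x, ((Finset.univ.filter fun y => ¬ G.Adj x y).card : ℝ) ≤ b)
    (x : ℕ → V) (m : ℕ) (hm : m * b < Fintype.card V) : ∃ y, ∀ j < m, G.Adj (x j) y := by
  classical
  by_contra! h
  have hcover : (Finset.univ : Finset V) ⊆
      (Finset.range m).biUnion fun j => Finset.univ.filter fun y => ¬ G.Adj (x j) y := by
    intro y _
    simpa using h y
  have hle : (Fintype.card V : ℝ) ≤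
      ∑ j ∈ Finset.range m, ((Finset.univ.filter fun y => ¬ G.Adj (x j) y).card : ℝ) := by
    exact_mod_cast (Finset.card_le_card hcover).trans Finset.card_biUnion_le
  have := hle.trans (Finset.sum_le_sum fun j _ => hb (x j))
  simp only [Finset.sum_const, Finset.card_range, nsmul_eq_mul] at this
  linarith

/-- For a greedily chosen sequence `x 0, …, x k`, the total of `f` is bounded by assigning to each
vertex the value of `f` at the first member of the sequence it is not adjacent to. -/
theorem sum_le_of_greedy {V : Type*} [Fintype V] (G : SimpleGraph V) [DecidableRel G.Adj]
    (b : ℝ) (hb : ∀ x, ((Finset.univ.filter fun y => ¬ G.Adj x y).card : ℝ) ≤ b)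
    (f : V → ℕ) (x : ℕ → V) (k : ℕ)
    (hadj : ∀ i ≤ k, ∀ j < i, G.Adj (x j) (x i))
    (hmax : ∀ i ≤ k, ∀ y, (∀ j < i, G.Adj (x j) y) → f y ≤ f (x i)) :
    ∑ y, (f y : ℝ) ≤ Fintype.card V * f (x k) +
      ∑ i ∈ Finset.range k, ((f (x i) : ℝ) - f (x k)) * b := by
  have hanti : ∀ i ∈ Finset.range k, 0 ≤ (f (x i) : ℝ) - f (x k) := fun i hi => by
    have hi := Finset.mem_range.mp hi
    exact sub_nonneg.mpr <| Nat.cast_le.mpr <|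
      hmax i hi.le _ fun j hj => hadj k le_rfl j (hj.trans hi)
  have hpoint : ∀ y, (f y : ℝ) ≤
      f (x k) + ∑ i ∈ Finset.range k, if ¬ G.Adj (x i) y then (f (x i) : ℝ) - f (x k) else 0 := by
    intro y
    have hnonneg : ∀ i ∈ Finset.range k,
        0 ≤ if ¬ G.Adj (x i) y then (f (x i) : ℝ) - f (x k) else 0 := fun i hi => by
      split_ifs
      exacts [le_rfl, hanti i hi]
    by_cases h : ∃ i, i < k ∧ ¬ G.Adj (x i) y
    · classical
      obtain ⟨hik, hi⟩ := Nat.find_spec h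
      have hle : (f y : ℝ) ≤ f (x (Nat.find h)) := Nat.cast_le.mpr <|
        hmax _ hik.le y fun j hj => by
          by_contra hj'
          exact Nat.find_min h hj ⟨hj.trans hik, hj'⟩
      have := Finset.single_le_sum hnonneg (Finset.mem_range.mpr hik)
      rw [if_pos hi] at this
      linarith
    · push Not at h
      have hle : (f y : ℝ) ≤ f (x k) := Nat.cast_le.mpr (hmax k le_rfl y h)
      linarith [Finset.sum_nonneg hnonneg]
  calc ∑ y, (f y : ℝ)
      ≤ ∑ y, (f (x k) + ∑ i ∈ Finset.range k,
          if ¬ G.Adj (x i) y then (f (x i) : ℝ) - f (x k) else 0) :=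
        Finset.sum_le_sum fun y _ => hpoint y
    _ = Fintype.card V * f (x k) + ∑ i ∈ Finset.range k,
          ((f (x i) : ℝ) - f (x k)) * (Finset.univ.filter fun y => ¬ G.Adj (x i) y).card := by
        rw [Finset.sum_add_distrib, Finset.sum_comm]
        congr 1
        · simp
        · refine Finset.sum_congr rfl fun i _ => ?_
          rw [← Finset.sum_filter, Finset.sum_const, nsmul_eq_mul, mul_comm]
    _ ≤ _ := by
        gcongr with i hi
        · exact hanti i hi
        · exact hb _

/-- Claim 3.2: under the hypotheses of Theorem 1.4 together with
`Σ_x ‖v(x)‖ > ((s−3)(r−1)+1)/((s−2)(r−1)+1)·t·n`, there is a clique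
`x₀, …, x_{s−3}` with total weight `1 + t(s−3)`, with `x₀` of maximum weight and
each `x_{i+1}` of maximum weight among the common neighbors of `x₀, …, x_i`. -/
theorem exists_heavy_clique (r s : ℕ) (hr : 3 ≤ r) (hs : 3 ≤ s)
    (V : Type) [Fintype V] (G : SimpleGraph V)
    (v : V → Fin (r + s - 3) → ZMod 2)
    (hδ : ∀ x : V,
      ((((s : ℝ) - 3) * ((r : ℝ) - 1) + 1) / (((s : ℝ) - 2) * ((r : ℝ) - 1) + 1)) *
          (Nat.card V) ≤ (G.neighborSet x).ncard)
    (hcode : ∀ S : Finset V, S.card = s - 2 → G.IsClique (S : Set V) →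
      (Finset.univ.filter fun j : Fin (r + s - 3) => ∀ x ∈ S, v x j = 1).card ≤ 1)
    (hbig : ((((s : ℝ) - 3) * ((r : ℝ) - 1) + 1) / (((s : ℝ) - 2) * ((r : ℝ) - 1) + 1)) *
        ((r + s - 3 : ℕ) : ℝ) * (Nat.card V) < ∑ x : V, (weight (v x) : ℝ)) :
    ∃ x : Fin (s - 2) → V, Function.Injective x ∧ G.IsClique (Set.range x) ∧
      (∑ j : Fin (s - 2), weight (v (x j))) = 1 + (r + s - 3) * (s - 3) ∧
      (∀ y : V, weight (v y) ≤ weight (v (x ⟨0, by omega⟩))) ∧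
      (∀ i : ℕ, ∀ hi : i + 1 < s - 2, ∀ y : V,
        (∀ j : Fin (s - 2), (j : ℕ) ≤ i → G.Adj (x j) y) →
        weight (v y) ≤ weight (v (x ⟨i + 1, hi⟩))) := by
  classical
  obtain ⟨k, rfl⟩ : ∃ k, s = k + 3 := ⟨s - 3, by omega⟩
  revert v
  generalize r + (k + 3) - 3 = t
  intro v hcode hbig
  have hr' : (3 : ℝ) ≤ r := by exact_mod_cast hr
  have hk : (0 : ℝ) ≤ k := k.cast_nonneg
  rw [Nat.card_eq_fintype_card] at hδ hbig
  set n := (Fintype.card V : ℝ) with hn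
  have hne : Nonempty V := by
    by_contra h
    rw [not_nonempty_iff] at h
    simp [hn] at hbig
  have hnpos : 0 < n := by
    rw [hn]
    exact_mod_cast Fintype.card_pos
  have hs3 : ((k + 3 : ℕ) : ℝ) - 3 = k := by push_cast; ring
  have hs2 : ((k + 3 : ℕ) : ℝ) - 2 = k + 1 := by push_cast; ring
  rw [hs3, hs2] at hδ hbig
  set D : ℝ := (k + 1) * (r - 1) + 1 with hD
  have hDpos : 0 < D := by
    have := mul_nonneg (by linarith : (0 : ℝ) ≤ k + 1) (by linarith : (0 : ℝ) ≤ (r : ℝ) - 1)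
    linarith
  have hαβ : ((k : ℝ) * (r - 1) + 1) / D = 1 - (r - 1) / D := by
    field_simp
    rw [hD]
    ring
  set β : ℝ := (r - 1) / D with hβ
  have hb : ∀ x, ((Finset.univ.filter fun y => ¬ G.Adj x y).card : ℝ) ≤ β * n := by
    intro x
    have hsplit := Finset.card_filter_add_card_filter_not (s := Finset.univ) fun y => G.Adj x y
    have hncard : (G.neighborSet x).ncard = (Finset.univ.filter fun y => G.Adj x y).card := by
      rw [← Set.ncard_coe_finset]
      congr 1
      ext y
      simp
    have h := hδ x
    rw [hαβ, hncard] at h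
    have hsplit' : ((Finset.univ.filter fun y => G.Adj x y).card : ℝ) +
        (Finset.univ.filter fun y => ¬ G.Adj x y).card = n := by
      rw [hn]
      exact_mod_cast hsplit
    linarith
  have hkβ : k * β < 1 := by
    rw [hβ, ← mul_div_assoc, div_lt_one hDpos, hD]
    linarith
  have hβ0 : 0 ≤ β := div_nonneg (by linarith) hDpos.le
  obtain ⟨x, hx⟩ := exists_greedy_sequence G.Adj (fun y => weight (v y)) (k + 1) fun x m hm => by
    refine exists_common_neighbor G (β * n) hb x m ?_
    have hmk : (m : ℝ) ≤ k := by exact_mod_cast Nat.lt_succ_iff.mp hm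
    calc (m : ℝ) * (β * n) ≤ k * (β * n) := by gcongr
      _ = k * β * n := by ring
      _ < 1 * n := by gcongr
      _ = _ := one_mul n
  have hadj : ∀ i < k + 1, ∀ j < k + 1, i ≠ j → G.Adj (x i) (x j) := by
    intro i hi j hj hij
    rcases lt_or_gt_of_ne hij with h | h
    · exact (hx j hj).1 i h
    · exact ((hx i hi).1 j h).symm
  have hinj : Set.InjOn x (Finset.range (k + 1)) := by
    intro i hi j hj hij
    by_contra h
    exact (hadj i (by simpa using hi) j (by simpa using hj) h).ne hij
  have hupper : ∑ i ∈ Finset.range (k + 1), weight (v (x i)) ≤ 1 + t * k := by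
    have hcard : ((Finset.range (k + 1)).image x).card = k + 1 := by
      rw [Finset.card_image_of_injOn hinj, Finset.card_range]
    have hclique : G.IsClique (((Finset.range (k + 1)).image x : Finset V) : Set V) := by
      intro a ha b hb hab
      simp only [Finset.coe_image, Set.mem_image, Finset.coe_range, Set.mem_Iio] at ha hb
      obtain ⟨i, hi, rfl⟩ := ha
      obtain ⟨j, hj, rfl⟩ := hb
      exact hadj i hi j hj fun h => hab (by rw [h])
    have h1 := sum_weight_le v ((Finset.range (k + 1)).image x)
    rw [Finset.sum_image hinj, hcard] at h1
    exact h1.trans (Nat.add_le_add_right (hcode _ hcard hclique) _)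
  have hlower : 1 + t * k ≤ ∑ i ∈ Finset.range (k + 1), weight (v (x i)) := by
    by_contra! hlt
    have hle : ∑ i ∈ Finset.range (k + 1), weight (v (x i)) ≤ t * k := by omega
    have hle' : ∑ i ∈ Finset.range k, (weight (v (x i)) : ℝ) + weight (v (x k)) ≤ t * k := by
      rw [Finset.sum_range_succ] at hle
      exact_mod_cast hle
    have hgreedy := sum_le_of_greedy G (β * n) hb (fun y => weight (v y)) x k
      (fun i hi => (hx i (by omega)).1) (fun i hi => (hx i (by omega)).2)
    rw [← Finset.sum_mul, Finset.sum_sub_distrib, Finset.sum_const, Finset.card_range,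
      nsmul_eq_mul, ← hn] at hgreedy
    have hlast : (weight (v (x k)) : ℝ) ≤ t := by exact_mod_cast weight_le _
    set S : ℝ := ∑ i ∈ Finset.range k, (weight (v (x i)) : ℝ)
    set w : ℝ := (weight (v (x k)) : ℝ)
    have hcoef : 0 ≤ 1 - (k + 1) * β := by
      rw [hβ, ← mul_div_assoc, sub_nonneg, div_le_one hDpos, hD]
      linarith
    have hkey : w + (S - k * w) * β ≤ (1 - β) * t := by
      have h1 := mul_le_mul_of_nonneg_left hle' hβ0
      have h2 := mul_le_mul_of_nonneg_left hlast hcoef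
      linarith
    have := mul_le_mul_of_nonneg_right hkey hnpos.le
    rw [hαβ] at hbig
    linarith
  refine ⟨fun i => x i, fun i j hij => Fin.ext <|
    hinj (Finset.mem_coe.mpr (Finset.mem_range.mpr i.isLt))
      (Finset.mem_coe.mpr (Finset.mem_range.mpr j.isLt)) hij, ?_, ?_,
    fun y => (hx 0 (by omega)).2 y (by simp), fun i hi y hy => (hx (i + 1) hi).2 y fun j hj => ?_⟩
  · rintro _ ⟨i, rfl⟩ _ ⟨j, rfl⟩ hij
    exact hadj i i.isLt j j.isLt fun h => hij (by simp only [h])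
  · exact (Fin.sum_univ_eq_sum_range (fun i => weight (v (x i))) (k + 1)).trans
      (le_antisymm hupper hlower)
  · exact hy ⟨j, by omega⟩ (Nat.lt_succ_iff.mp hj)
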